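/- Let n ≥ 2, let E be n-dimensional Euclidean space, and for a continuous linear map A : E → E define V_A : E → E by V_A(v) := A v − ⟨v, A v⟩ v. Let v ∈ E with ‖v‖ = 1 and let (e_1, …, e_{n-1}) be any orthonormal basis of the orthogonal complement {v}^⊥. Then the sum over i of ⟨e_i, DV_A(v)·e_i⟩ equals tr(A) − n·⟨v, A v⟩, where DV_A(v) is the Fréchet derivative of V_A at v and tr(A) is the trace of A. (This is the identity Div V_A(v) = tr A − n⟨v,Av⟩ for the divergence of the projective vector field V_A on the unit sphere S^{n-1}.) -/

import Mathlib

open scoped RealInnerProductSpace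

/-- The projective vector field `V_A(v) = A v − ⟨v, A v⟩ v` on Euclidean space induced by
a continuous linear map `A`. -/
noncomputable def projVF {n : ℕ} (A : EuclideanSpace ℝ (Fin n) →L[ℝ] EuclideanSpace ℝ (Fin n))
    (v : EuclideanSpace ℝ (Fin n)) : EuclideanSpace ℝ (Fin n) :=
  A v - ⟪v, A v⟫ • v

/-- The trace of an endomorphism is its compression to the line spanned by a unit vector `v` plus
its compression to the orthogonal complement of that line. -/
theorem LinearMap.trace_eq_inner_add_sum_orthogonal {E ι : Type*} [NormedAddCommGroup E]
    [InnerProductSpace ℝ E] [FiniteDimensional ℝ E] [Fintype ι] (T : E →ₗ[ℝ] E) {v : E}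
    (hv : ‖v‖ = 1) (b : OrthonormalBasis ι ℝ ((ℝ ∙ v)ᗮ : Submodule ℝ E)) :
    LinearMap.trace ℝ E T = ⟪v, T v⟫ + ∑ i, ⟪(b i : E), T (b i)⟫ := by
  classical
  have hperp (i : ι) : ⟪v, (b i : E)⟫ = 0 :=
    Submodule.mem_orthogonal_singleton_iff_inner_right.mp (b i).2
  have hb : Orthonormal ℝ fun i => (b i : E) :=
    b.orthonormal.comp_linearIsometry (Submodule.subtypeₗᵢ _)
  let w : Option ι → E := fun o => o.elim v fun i => (b i : E)
  have hw : Orthonormal ℝ w := by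
    rw [orthonormal_iff_ite] at hb ⊢
    rintro (_ | i) (_ | j)
    · simp [w, hv]
    · simpa [w] using hperp j
    · simpa [w, real_inner_comm] using hperp i
    · simpa [w] using hb i j
  have hspan : ⊤ ≤ Submodule.span ℝ (Set.range w) := by
    have hcard : Fintype.card (Option ι) = Module.finrank ℝ E := by
      have h := Submodule.finrank_add_finrank_orthogonal (ℝ ∙ v)
      rw [finrank_span_singleton (norm_ne_zero_iff.mp (by simp [hv])),
        Module.finrank_eq_card_basis b.toBasis] at h
      rw [Fintype.card_option, ← h, add_comm]
    exact (hw.linearIndependent.span_eq_top_of_card_eq_finrank' hcard).ge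
  rw [LinearMap.trace_eq_sum_inner T (OrthonormalBasis.mk hw hspan), Fintype.sum_option]
  simp [w]

theorem hasFDerivAt_projVF {n : ℕ}
    (A : EuclideanSpace ℝ (Fin n) →L[ℝ] EuclideanSpace ℝ (Fin n)) (v : EuclideanSpace ℝ (Fin n)) :
    HasFDerivAt (projVF A) (A - (⟪v, A v⟫ • ContinuousLinearMap.id ℝ _ +
      ((fderivInnerCLM ℝ (v, A v)).comp ((ContinuousLinearMap.id ℝ _).prod A)).smulRight v)) v :=
  A.hasFDerivAt.sub (((hasFDerivAt_id v).inner ℝ A.hasFDerivAt).smul (hasFDerivAt_id v))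

/-- Divergence identity for the projective vector field `V_A` on the unit sphere: for a
unit vector `v` and any orthonormal basis `(e_1, …, e_{n-1})` of `{v}ᗮ`,
`∑ i ⟨e_i, DV_A(v)·e_i⟩ = tr A − n ⟨v, A v⟩`. -/
theorem div_projVF {n : ℕ} (hn : 2 ≤ n)
    (A : EuclideanSpace ℝ (Fin n) →L[ℝ] EuclideanSpace ℝ (Fin n))
    (v : EuclideanSpace ℝ (Fin n)) (hv : ‖v‖ = 1)
    (b : OrthonormalBasis (Fin (n - 1)) ℝ ((ℝ ∙ v)ᗮ : Submodule ℝ (EuclideanSpace ℝ (Fin n)))) :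
    ∑ i : Fin (n - 1), ⟪((b i : EuclideanSpace ℝ (Fin n))),
        fderiv ℝ (projVF A) v (b i)⟫ =
      LinearMap.trace ℝ (EuclideanSpace ℝ (Fin n)) (A : _ →ₗ[ℝ] _) - n * ⟪v, A v⟫ := by
  have hterm (i : Fin (n - 1)) : ⟪(b i : EuclideanSpace ℝ (Fin n)), fderiv ℝ (projVF A) v (b i)⟫ =
      ⟪(b i : EuclideanSpace ℝ (Fin n)), A (b i)⟫ - ⟪v, A v⟫ := by
    have hperp : ⟪(b i : EuclideanSpace ℝ (Fin n)), v⟫ = 0 :=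
      Submodule.mem_orthogonal_singleton_iff_inner_left.mp (b i).2
    have hnorm : ‖(b i : EuclideanSpace ℝ (Fin n))‖ = 1 := b.orthonormal.1 i
    rw [(hasFDerivAt_projVF A v).fderiv]
    simp [inner_sub_right, inner_add_right, real_inner_smul_right, hperp, hnorm]
  rw [Finset.sum_congr rfl fun i _ => hterm i,
    LinearMap.trace_eq_inner_add_sum_orthogonal _ hv b]
  simp only [Finset.sum_sub_distrib, Finset.sum_const, Finset.card_univ, Fintype.card_fin,
    nsmul_eq_mul, Nat.cast_sub (one_le_two.trans hn), Nat.cast_one, ContinuousLinearMap.coe_coe]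
  ring
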